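/- Let μ be of separated type and q ≥ 0. (i) If max{γ_A(q), γ_B(q)} ≤ τ_1(q)+τ_2(q), then γ(q) = max{γ_A(q), γ_B(q)}. (ii) If min{γ_A(q), γ_B(q)} ≥ τ_1(q)+τ_2(q), then γ(q) ≤ min{γ_A(q), γ_B(q)}, with equality if at least one of the following holds: (1) Σ_{i∈I} p_i^q c_i^{τ_1(q)} d_i^{γ_A(q)−τ_1(q)} log(c_i/d_i) ≥ 0; (2) Σ_{i∈I} p_i^q d_i^{τ_2(q)} c_i^{γ_B(q)−τ_2(q)} log(d_i/c_i) ≥ 0. (iii) Moreover, if c_i ≥ d_i for all i ∈ I, then γ(q) = γ_A(q) for all q ≥ 0, and if d_i ≥ c_i for all i ∈ I, then γ(q) = γ_B(q) for all q ≥ 0, without any additional assumptions. -/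

import Mathlib

open MeasureTheory Filter Set

attribute [local instance] Classical.propDecidable

noncomputable section

/-- Data of a box-like planar self-affine IFS: each map is `S i = T i ∘ L i + t i`, where
`T i` is the diagonal contraction `diag (c i, d i)` with `c i, d i ∈ (0,1)` and `L i` is a
linear isometry of the plane preserving `[-1,1]²`, i.e. one of the eight symmetries of the
square, encoded by whether it swaps the two axes (`swap`) and by a sign on each coordinate. -/
structure IFSData (ι : Type) where
  c : ι → ℝ
  d : ι → ℝ
  swap : ι → Bool
  sgn1 : ι → Bool
  sgn2 : ι → Bool
  t : ι → ℝ × ℝ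

namespace IFSData

variable {ι : Type}

/-- The affine contraction `S i = T i ∘ L i + t i`. -/
def S (B : IFSData ι) (i : ι) (x : ℝ × ℝ) : ℝ × ℝ :=
  ((if B.sgn1 i then 1 else -1) * (B.c i * (if B.swap i then x.2 else x.1)) + (B.t i).1,
   (if B.sgn2 i then 1 else -1) * (B.d i * (if B.swap i then x.1 else x.2)) + (B.t i).2)

/-- `(b(i), h(i))`: base and height of the rectangle `S_i([0,1]²)` for a finite word `i`. -/
def dims (B : IFSData ι) (l : List ι) : ℝ × ℝ :=
  l.foldr (fun i w =>
    (B.c i * (if B.swap i then w.2 else w.1), B.d i * (if B.swap i then w.1 else w.2))) (1, 1)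

/-- `α₁(i)`: the larger singular value of the linear part of `S_i`. -/
def alpha1 (B : IFSData ι) (l : List ι) : ℝ := max (B.dims l).1 (B.dims l).2

/-- `α₂(i)`: the smaller singular value of the linear part of `S_i`. -/
def alpha2 (B : IFSData ι) (l : List ι) : ℝ := min (B.dims l).1 (B.dims l).2

/-- Whether the composite map of the word maps horizontal lines to vertical lines. -/
def swapW (B : IFSData ι) (l : List ι) : Bool := l.foldr (fun i b => xor (B.swap i) b) false

/-- The composite map `S_{i₁} ∘ ⋯ ∘ S_{i_k}` of a word. -/
def Sw (B : IFSData ι) (l : List ι) : ℝ × ℝ → ℝ × ℝ := l.foldr (fun i f => B.S i ∘ f) id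

/-- The word `i` projects onto the first coordinate, i.e. `π_i = π₁`. -/
def usesPi1 (B : IFSData ι) (l : List ι) : Prop :=
  (B.swapW l = false ∧ (B.dims l).2 ≤ (B.dims l).1) ∨
    (B.swapW l = true ∧ (B.dims l).1 < (B.dims l).2)

/-- The projection `π_i` onto the direction of the longest side of `S_i([0,1]²)`. -/
def projW (B : IFSData ι) (l : List ι) : ℝ × ℝ → ℝ :=
  if B.usesPi1 l then Prod.fst else Prod.snd

/-- The rectangular open set condition. -/
def ROSC (B : IFSData ι) : Prop :=
  ∃ x₁ x₂ y₁ y₂ : ℝ, x₁ < x₂ ∧ y₁ < y₂ ∧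
    (∀ i, B.S i '' (Set.Ioo x₁ x₂ ×ˢ Set.Ioo y₁ y₂) ⊆ Set.Ioo x₁ x₂ ×ˢ Set.Ioo y₁ y₂) ∧
    Pairwise fun i j =>
      Disjoint (B.S i '' (Set.Ioo x₁ x₂ ×ˢ Set.Ioo y₁ y₂))
        (B.S j '' (Set.Ioo x₁ x₂ ×ˢ Set.Ioo y₁ y₂))

end IFSData

/-- `p(i)`: the probability of a finite word. -/
def wordProb {ι : Type} (p : ι → ℝ) (l : List ι) : ℝ := (l.map p).prod

/-- `τ_i(q)`: the value of the `L^q`-spectrum of the projection `π_i μ`. -/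
def tauW {ι : Type} (B : IFSData ι) (τ1 τ2 : ℝ → ℝ) (l : List ι) (q : ℝ) : ℝ :=
  if B.usesPi1 l then τ1 q else τ2 q

/-- The `q`-modified singular value function `ψ^{s,q}`. -/
def psiSV {ι : Type} (B : IFSData ι) (p : ι → ℝ) (τ1 τ2 : ℝ → ℝ) (s q : ℝ) (l : List ι) : ℝ :=
  wordProb p l ^ q * B.alpha1 l ^ tauW B τ1 τ2 l q * B.alpha2 l ^ (s - tauW B τ1 τ2 l q)

/-- `Ψ_k^{s,q} = ∑_{i ∈ I^k} ψ^{s,q}(i)`. -/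
def PsiSV {ι : Type} [Fintype ι] (B : IFSData ι) (p : ι → ℝ) (τ1 τ2 : ℝ → ℝ)
    (k : ℕ) (s q : ℝ) : ℝ :=
  ∑ f : Fin k → ι, psiSV B p τ1 τ2 s q (List.ofFn f)

/-- The lower `L^q`-spectrum of a measure. -/
def lowerLq {X : Type*} [MeasurableSpace X] [PseudoMetricSpace X] (ν : Measure X) (q : ℝ) : ℝ :=
  liminf (fun δ : ℝ =>
      Real.log (∫ x, (ν (Metric.ball x δ)).toReal ^ (q - 1) ∂ν) / (-Real.log δ))
    (nhdsWithin 0 (Set.Ioi 0))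

/-- The upper `L^q`-spectrum of a measure. -/
def upperLq {X : Type*} [MeasurableSpace X] [PseudoMetricSpace X] (ν : Measure X) (q : ℝ) : ℝ :=
  limsup (fun δ : ℝ =>
      Real.log (∫ x, (ν (Metric.ball x δ)).toReal ^ (q - 1) ∂ν) / (-Real.log δ))
    (nhdsWithin 0 (Set.Ioi 0))

/-- The `L^q`-spectrum of `ν` exists and equals `t`. -/
def IsLqSpec {X : Type*} [MeasurableSpace X] [PseudoMetricSpace X]
    (ν : Measure X) (q t : ℝ) : Prop :=
  lowerLq ν q = t ∧ upperLq ν q = t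

/-- `α_min = min_{i ∈ I} α₂(i)`. -/
def alphaMin {ι : Type} [Fintype ι] [Nonempty ι] (B : IFSData ι) : ℝ :=
  Finset.univ.inf' Finset.univ_nonempty fun i => min (B.c i) (B.d i)

/-- `α_max = max_{i ∈ I} α₁(i)`. -/
def alphaMax {ι : Type} [Fintype ι] [Nonempty ι] (B : IFSData ι) : ℝ :=
  Finset.univ.sup' Finset.univ_nonempty fun i => max (B.c i) (B.d i)

/-- `p_max = max_{i ∈ I} p_i`. -/
def pMax {ι : Type} [Fintype ι] [Nonempty ι] (p : ι → ℝ) : ℝ :=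
  Finset.univ.sup' Finset.univ_nonempty p

/-- The `δ`-stopping `I_δ`. -/
def stopping {ι : Type} (B : IFSData ι) (δ : ℝ) : Set (List ι) :=
  {l | l ≠ [] ∧ B.alpha2 l < δ ∧ δ ≤ B.alpha2 l.dropLast}

lemma sum_ofFn_succ {ι : Type} [Fintype ι] (k : ℕ) (g : List ι → ℝ) :
    ∑ f : Fin (k+1) → ι, g (List.ofFn f) = ∑ i : ι, ∑ f : Fin k → ι, g (i :: List.ofFn f) := by
  rw [← (Fin.consEquiv (fun _ : Fin (k+1) => ι)).sum_comp, Fintype.sum_prod_type]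
  refine Finset.sum_congr rfl fun i _ => Finset.sum_congr rfl fun f _ => ?_
  congr 1
  simp [Fin.consEquiv, List.ofFn_succ]

lemma sum_words_prod {ι : Type} [Fintype ι] (w : ι → ℝ) (k : ℕ) :
    ∑ f : Fin k → ι, ((List.ofFn f).map w).prod = (∑ i, w i) ^ k := by
  induction k with
  | zero => simp
  | succ k ih =>
    rw [sum_ofFn_succ k (fun l => (l.map w).prod)]
    simp only [List.map_cons, List.prod_cons, ← Finset.mul_sum, ih]
    rw [← Finset.sum_mul, pow_succ]; ring

lemma sum_words_lin {ι : Type} [Fintype ι] (w z : ι → ℝ) (hw : ∑ i, w i = 1)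
    (hz : ∑ i, w i * z i = 0) (k : ℕ) :
    ∑ f : Fin k → ι, ((List.ofFn f).map w).prod * ((List.ofFn f).map z).sum = 0 := by
  induction k with
  | zero => simp
  | succ k ih =>
    rw [sum_ofFn_succ k (fun l => (l.map w).prod * (l.map z).sum)]
    have : ∀ i, ∑ f : Fin k → ι, ((i :: List.ofFn f).map w).prod * ((i :: List.ofFn f).map z).sum
        = w i * z i := by
      intro i
      have h1 : ∀ f : Fin k → ι,
          ((i :: List.ofFn f).map w).prod * ((i :: List.ofFn f).map z).sum
          = w i * z i * ((List.ofFn f).map w).prod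
            + w i * (((List.ofFn f).map w).prod * ((List.ofFn f).map z).sum) := by
        intro f; simp only [List.map_cons, List.prod_cons, List.sum_cons]; ring
      simp_rw [h1]
      rw [Finset.sum_add_distrib, ← Finset.mul_sum, ← Finset.mul_sum, ih, sum_words_prod, hw]
      simp
    simp_rw [this]
    exact hz

lemma sum_words_sq {ι : Type} [Fintype ι] (w z : ι → ℝ) (hw : ∑ i, w i = 1)
    (hz : ∑ i, w i * z i = 0) (k : ℕ) :
    ∑ f : Fin k → ι, ((List.ofFn f).map w).prod * ((List.ofFn f).map z).sum ^ 2
      = k * ∑ i, w i * z i ^ 2 := by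
  induction k with
  | zero => simp
  | succ k ih =>
    rw [sum_ofFn_succ k (fun l => (l.map w).prod * (l.map z).sum ^ 2)]
    have : ∀ i, ∑ f : Fin k → ι,
        ((i :: List.ofFn f).map w).prod * ((i :: List.ofFn f).map z).sum ^ 2
        = w i * z i ^ 2 + w i * (k * ∑ i, w i * z i ^ 2) := by
      intro i
      have h1 : ∀ f : Fin k → ι,
          ((i :: List.ofFn f).map w).prod * ((i :: List.ofFn f).map z).sum ^ 2
          = w i * z i ^ 2 * ((List.ofFn f).map w).prod
            + 2 * w i * z i * (((List.ofFn f).map w).prod * ((List.ofFn f).map z).sum)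
            + w i * (((List.ofFn f).map w).prod * ((List.ofFn f).map z).sum ^ 2) := by
        intro f; simp only [List.map_cons, List.prod_cons, List.sum_cons]; ring
      simp_rw [h1]
      rw [Finset.sum_add_distrib, Finset.sum_add_distrib, ← Finset.mul_sum, ← Finset.mul_sum,
        ← Finset.mul_sum, ih, sum_words_prod, sum_words_lin w z hw hz, hw]
      simp
    simp_rw [this]
    rw [Finset.sum_add_distrib, ← Finset.sum_mul, hw]
    push_cast; ring

lemma words_lower {ι : Type} [Fintype ι] (w y : ι → ℝ) (hw0 : ∀ i, 0 ≤ w i)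
    (hw : ∑ i, w i = 1) (hy : 0 ≤ ∑ i, w i * y i) (θ : ℝ) (hθ : 0 ≤ θ) :
    ∃ K : ℝ, ∀ k : ℕ, 0 < k → Real.exp (- (Real.sqrt k * K)) ≤
      ∑ f : Fin k → ι, ((List.ofFn f).map w).prod *
        min 1 (Real.exp (θ * ((List.ofFn f).map y).sum)) := by
  set m := ∑ i, w i * y i with hm
  set z : ι → ℝ := fun i => y i - m with hzdef
  have hz : ∑ i, w i * z i = 0 := by
    simp only [hzdef, mul_sub, Finset.sum_sub_distrib, ← Finset.sum_mul, hw]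
    simp [hm]
  set V := ∑ i, w i * z i ^ 2 with hV
  refine ⟨θ * (1 + V) / 2, fun k hk => ?_⟩
  set r := Real.sqrt k with hr
  have hr0 : 0 < r := Real.sqrt_pos.mpr (by exact_mod_cast hk)
  have hrr : r * r = k := Real.mul_self_sqrt (by positivity)
  set a := - (r * (θ * (1 + V) / 2)) with ha
  have key : ∀ f : Fin k → ι,
      ((List.ofFn f).map w).prod * (Real.exp a * (1 - a - θ * r / 2))
        - (Real.exp a * θ / (2 * r)) *
          (((List.ofFn f).map w).prod * ((List.ofFn f).map z).sum ^ 2) ≤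
      ((List.ofFn f).map w).prod *
        min 1 (Real.exp (θ * ((List.ofFn f).map y).sum)) := by
    intro f
    have hW : 0 ≤ ((List.ofFn f).map w).prod := by
      apply List.prod_nonneg
      intro x hx
      obtain ⟨i, _, rfl⟩ := List.mem_map.1 hx
      exact hw0 i
    have hYZ : ((List.ofFn f).map z).sum ≤ ((List.ofFn f).map y).sum := by
      apply List.sum_le_sum
      intro i _
      simp only [hzdef]; linarith
    set W := ((List.ofFn f).map w).prod
    set Z := ((List.ofFn f).map z).sum
    set Y := ((List.ofFn f).map y).sum
    have h1 : - (θ * (r + Z ^ 2 / r) / 2) ≤ min 0 (θ * Y) := by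
      have h2 : - (r + Z ^ 2 / r) / 2 ≤ Z := by
        have : r + Z ^ 2 / r + 2 * Z = (r + Z) ^ 2 / r := by field_simp; ring
        have : 0 ≤ (r + Z) ^ 2 / r := by positivity
        linarith
      have h3 : 0 ≤ Z ^ 2 / r := by positivity
      apply le_min
      · have : 0 ≤ θ * (r + Z ^ 2 / r) := by positivity
        linarith
      · have := mul_le_mul_of_nonneg_left (h2.trans hYZ) hθ
        linarith
    have h4 : min 1 (Real.exp (θ * Y)) = Real.exp (min 0 (θ * Y)) := by
      rw [Real.exp_monotone.map_min, Real.exp_zero]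
    have h5 : Real.exp a * (1 - a - θ * (r + Z ^ 2 / r) / 2) ≤ Real.exp (min 0 (θ * Y)) := by
      have : Real.exp (min 0 (θ * Y)) = Real.exp a * Real.exp (min 0 (θ * Y) - a) := by
        rw [← Real.exp_add]; ring_nf
      rw [this]
      apply mul_le_mul_of_nonneg_left _ (Real.exp_pos a).le
      have := Real.add_one_le_exp (min 0 (θ * Y) - a)
      linarith
    rw [h4]
    refine le_trans (le_of_eq ?_) (mul_le_mul_of_nonneg_left h5 hW)
    field_simp
    ring
  refine le_trans (le_of_eq ?_) (Finset.sum_le_sum fun f _ => key f)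
  rw [Finset.sum_sub_distrib, ← Finset.sum_mul, ← Finset.mul_sum, sum_words_prod,
    sum_words_sq w z hw hz, hw, ← hV, ← hrr, ha]
  field_simp
  ring

lemma word_formula {ι : Type} (p c d : ι → ℝ) (hp : ∀ i, 0 < p i) (hc : ∀ i, 0 < c i)
    (hd : ∀ i, 0 < d i) (q t u : ℝ) (l : List ι) :
    (l.map (fun i => p i ^ q * c i ^ t * d i ^ u)).prod =
      wordProb p l ^ q * (l.map c).prod ^ t * (l.map d).prod ^ u ∧
    0 < wordProb p l ∧ 0 < (l.map c).prod ∧ 0 < (l.map d).prod ∧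
    (l.map (fun i => Real.log (c i / d i))).sum =
      Real.log (l.map c).prod - Real.log (l.map d).prod := by
  unfold wordProb
  induction l with
  | nil => simp
  | cons i l ih =>
    obtain ⟨h1, h2, h3, h4, h5⟩ := ih
    have := hp i; have := hc i; have := hd i
    simp only [List.map_cons, List.prod_cons, List.sum_cons, h1, h5]
    refine ⟨?_, by positivity, by positivity, by positivity, ?_⟩
    · rw [Real.mul_rpow (by positivity) h2.le, Real.mul_rpow (by positivity) h3.le,
        Real.mul_rpow (by positivity) h4.le]
      ring
    · rw [Real.log_div (by positivity) (by positivity), Real.log_mul (by positivity) h3.ne',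
        Real.log_mul (by positivity) h4.ne']
      ring

lemma sep_dims {ι : Type} (B : IFSData ι) (hsep : ∀ i, B.swap i = false) (l : List ι) :
    B.dims l = ((l.map B.c).prod, (l.map B.d).prod) ∧ B.swapW l = false := by
  unfold IFSData.dims IFSData.swapW
  induction l with
  | nil => simp
  | cons i l ih =>
    simp only [hsep] at ih
    obtain ⟨h1, h2⟩ := ih
    simp only [hsep, List.foldr_cons, List.map_cons, List.prod_cons, h1, h2]
    simp

lemma psi_cases {ι : Type} (B : IFSData ι) (hsep : ∀ i, B.swap i = false)
    (p : ι → ℝ) (hp : ∀ i, 0 < p i) (hc : ∀ i, 0 < B.c i)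
    (hd : ∀ i, 0 < B.d i) (τ1 τ2 : ℝ → ℝ) (s q : ℝ) (l : List ι) :
    ((l.map B.d).prod ≤ (l.map B.c).prod → psiSV B p τ1 τ2 s q l =
      (l.map (fun i => p i ^ q * B.c i ^ τ1 q * B.d i ^ (s - τ1 q))).prod) ∧
    ((l.map B.c).prod ≤ (l.map B.d).prod → psiSV B p τ1 τ2 s q l =
      (l.map (fun i => p i ^ q * B.d i ^ τ2 q * B.c i ^ (s - τ2 q))).prod) := by
  obtain ⟨h1, h2, h3, h4, -⟩ := word_formula p B.c B.d hp hc hd q (τ1 q) (s - τ1 q) l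
  obtain ⟨g1, -, -, -, -⟩ := word_formula p B.d B.c hp hd hc q (τ2 q) (s - τ2 q) l
  obtain ⟨e1, e2⟩ := sep_dims B hsep l
  rw [h1, g1]
  unfold psiSV tauW IFSData.usesPi1 IFSData.alpha1 IFSData.alpha2
  simp only [e1, e2]
  constructor
  · intro h
    simp [h]
  · intro h
    rcases h.eq_or_lt with h | h
    · simp only [h, le_refl, and_self, true_or, if_true, max_self, min_self]
      rw [mul_assoc, mul_assoc, ← Real.rpow_add h4, ← Real.rpow_add h4]
      ring_nf
    · simp [h.not_ge, h.le]

lemma AB_ratio {ι : Type} (p c d : ι → ℝ) (hp : ∀ i, 0 < p i) (hc : ∀ i, 0 < c i)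
    (hd : ∀ i, 0 < d i) (q s t1 t2 : ℝ) (l : List ι) :
    (l.map (fun i => p i ^ q * d i ^ t2 * c i ^ (s - t2))).prod =
    (l.map (fun i => p i ^ q * c i ^ t1 * d i ^ (s - t1))).prod *
      Real.exp ((s - (t1 + t2)) * (l.map (fun i => Real.log (c i / d i))).sum) := by
  obtain ⟨h1, h2, h3, h4, h5⟩ := word_formula p c d hp hc hd q t1 (s - t1) l
  obtain ⟨g1, -, -, -, -⟩ := word_formula p d c hp hd hc q t2 (s - t2) l
  rw [h1, g1, h5, Real.rpow_def_of_pos h3, Real.rpow_def_of_pos h3, Real.rpow_def_of_pos h4,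
    Real.rpow_def_of_pos h4, mul_assoc, mul_assoc, mul_assoc, ← Real.exp_add, ← Real.exp_add,
    ← Real.exp_add]
  ring_nf

lemma psi_pos {ι : Type} (B : IFSData ι) (hsep : ∀ i, B.swap i = false)
    (p : ι → ℝ) (hp : ∀ i, 0 < p i) (hc : ∀ i, 0 < B.c i)
    (hd : ∀ i, 0 < B.d i) (τ1 τ2 : ℝ → ℝ) (s q : ℝ) (l : List ι) :
    0 < psiSV B p τ1 τ2 s q l ∧ 0 < B.alpha2 l := by
  obtain ⟨h1, h2, h3, h4, -⟩ := word_formula p B.c B.d hp hc hd q (τ1 q) (s - τ1 q) l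
  obtain ⟨e1, e2⟩ := sep_dims B hsep l
  have a1 : 0 < B.alpha1 l := by unfold IFSData.alpha1; rw [e1]; exact lt_max_of_lt_left h3
  have a2 : 0 < B.alpha2 l := by unfold IFSData.alpha2; rw [e1]; exact lt_min h3 h4
  refine ⟨?_, a2⟩
  unfold psiSV
  positivity

lemma Psi_mono {ι : Type} [Fintype ι] (B : IFSData ι) (hsep : ∀ i, B.swap i = false)
    (p : ι → ℝ) (hp : ∀ i, 0 < p i) (hc : ∀ i, 0 < B.c i)
    (hd : ∀ i, 0 < B.d i) (τ1 τ2 : ℝ → ℝ) (q : ℝ) (L : ℝ) (hL : 0 < L)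
    (hdL : ∀ i, B.d i ≤ L) (s s' : ℝ) (hs : s ≤ s') (k : ℕ) :
    PsiSV B p τ1 τ2 k s' q ≤ (L ^ (s' - s)) ^ k * PsiSV B p τ1 τ2 k s q := by
  unfold PsiSV
  rw [Finset.mul_sum]
  refine Finset.sum_le_sum fun f _ => ?_
  obtain ⟨h1, h2⟩ := psi_pos B hsep p hp hc hd τ1 τ2 s q (List.ofFn f)
  have h3 : psiSV B p τ1 τ2 s' q (List.ofFn f) =
      B.alpha2 (List.ofFn f) ^ (s' - s) * psiSV B p τ1 τ2 s q (List.ofFn f) := by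
    unfold psiSV
    rw [show s' - tauW B τ1 τ2 (List.ofFn f) q =
      (s' - s) + (s - tauW B τ1 τ2 (List.ofFn f) q) by ring, Real.rpow_add h2]
    ring
  have h4 : B.alpha2 (List.ofFn f) ≤ L ^ k := by
    have h5 : B.alpha2 (List.ofFn f) ≤ ((List.ofFn f).map B.d).prod := by
      unfold IFSData.alpha2
      rw [(sep_dims B hsep _).1]
      exact min_le_right _ _
    refine h5.trans ?_
    rw [List.map_ofFn, List.prod_ofFn]
    calc _ ≤ ∏ _i : Fin k, L := Finset.prod_le_prod (fun i _ => (hd _).le) (fun i _ => hdL _)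
      _ = _ := by simp
  rw [h3]
  apply mul_le_mul_of_nonneg_right _ h1.le
  calc _ ≤ (L ^ k) ^ (s' - s) := Real.rpow_le_rpow h2.le h4 (by linarith)
    _ = _ := by
      rw [← Real.rpow_natCast, ← Real.rpow_natCast, ← Real.rpow_mul hL.le, ← Real.rpow_mul hL.le,
        mul_comm]

lemma lim_root_le {u : ℕ → ℝ} {x : ℝ} (h0 : ∀ k, 0 ≤ u k)
    (hu : Tendsto (fun k : ℕ => u k ^ ((k : ℝ)⁻¹)) atTop (nhds x)) (h : ∀ k, u k ≤ 2) :
    x ≤ 1 := by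
  have h1 : Tendsto (fun k : ℕ => (2 : ℝ) ^ ((k : ℝ)⁻¹)) atTop (nhds 1) := by
    have := (tendsto_inv_atTop_nhds_zero_nat (𝕜 := ℝ))
    have h2 := (Real.continuous_const_rpow (a := (2:ℝ)) (by norm_num)).tendsto 0
    simpa [Function.comp_def] using h2.comp this
  exact le_of_tendsto_of_tendsto' hu h1 fun k => Real.rpow_le_rpow (h0 k) (h k) (by positivity)

lemma lim_root_ge {u : ℕ → ℝ} {x K : ℝ}
    (hu : Tendsto (fun k : ℕ => u k ^ ((k : ℝ)⁻¹)) atTop (nhds x))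
    (h : ∀ k : ℕ, 0 < k → Real.exp (- (Real.sqrt k * K)) ≤ u k) :
    1 ≤ x := by
  have h1 : Tendsto (fun k : ℕ => Real.exp (- (K * (Real.sqrt (k : ℝ))⁻¹))) atTop (nhds 1) := by
    have h3 : Tendsto (fun k : ℕ => (Real.sqrt (k : ℝ))⁻¹) atTop (nhds 0) :=
      tendsto_inv_atTop_zero.comp (Real.tendsto_sqrt_atTop.comp tendsto_natCast_atTop_atTop)
    have h4 := (h3.const_mul K).neg
    have := (Real.continuous_exp.tendsto _).comp h4
    simpa [Function.comp_def] using this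
  refine le_of_tendsto_of_tendsto h1 hu ?_
  filter_upwards [eventually_gt_atTop 0] with k hk
  have hk' : (0 : ℝ) < Real.sqrt k := Real.sqrt_pos.mpr (by exact_mod_cast hk)
  have hkk : Real.sqrt k * Real.sqrt k = k := Real.mul_self_sqrt (by positivity)
  refine le_trans (le_of_eq ?_) (Real.rpow_le_rpow (Real.exp_pos _).le (h k hk) (by positivity))
  rw [← Real.exp_mul]
  congr 1
  generalize Real.sqrt (k : ℝ) = r at hk' hkk
  rw [← hkk]
  field_simp

lemma lim_root_mono {u v : ℕ → ℝ} {x y a : ℝ} (ha : 0 ≤ a) (h0 : ∀ k, 0 ≤ u k)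
    (h0' : ∀ k, 0 ≤ v k)
    (hu : Tendsto (fun k : ℕ => u k ^ ((k : ℝ)⁻¹)) atTop (nhds x))
    (hv : Tendsto (fun k : ℕ => v k ^ ((k : ℝ)⁻¹)) atTop (nhds y))
    (h : ∀ k, v k ≤ a ^ k * u k) : y ≤ a * x := by
  refine le_of_tendsto_of_tendsto hv (hu.const_mul a) ?_
  filter_upwards [eventually_gt_atTop 0] with k hk
  refine (Real.rpow_le_rpow (h0' k) (h k) (by positivity)).trans (le_of_eq ?_)
  rw [Real.mul_rpow (by positivity) (h0 k), Real.pow_rpow_inv_natCast ha hk.ne']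

lemma weight_anti {ι : Type} [Fintype ι] (p c d : ι → ℝ) (hp : ∀ i, 0 < p i) (hc : ∀ i, 0 < c i)
    (hd : ∀ i, d i ∈ Set.Ioo (0:ℝ) 1) (q t s s' : ℝ) (h : s ≤ s')
    (h1 : ∑ i, p i ^ q * c i ^ t * d i ^ (s - t) = 1) :
    ∑ i, p i ^ q * c i ^ t * d i ^ (s' - t) ≤ 1 := by
  rw [← h1]
  refine Finset.sum_le_sum fun i _ => ?_
  have := hp i; have := hc i
  exact mul_le_mul_of_nonneg_left
    (Real.rpow_le_rpow_of_exponent_ge (hd i).1 (hd i).2.le (by linarith)) (by positivity)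

theorem closed_form_for_gamma_separated_type
    {ι : Type} [Fintype ι] [Nonempty ι] (hcard : 2 ≤ Fintype.card ι)
    (B : IFSData ι)
    (hc : ∀ i, B.c i ∈ Set.Ioo (0 : ℝ) 1) (hd : ∀ i, B.d i ∈ Set.Ioo (0 : ℝ) 1)
    (p : ι → ℝ) (hp : ∀ i, p i ∈ Set.Ioo (0 : ℝ) 1) (hpsum : ∑ i : ι, p i = 1)
    (μ : Measure (ℝ × ℝ)) [IsProbabilityMeasure μ]
    (hcpt : ∃ K : Set (ℝ × ℝ), IsCompact K ∧ μ Kᶜ = 0)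
    (hself : μ = ∑ i : ι, ENNReal.ofReal (p i) • Measure.map (B.S i) μ)
    (τ1 τ2 : ℝ → ℝ)
    (hτ1 : ∀ q : ℝ, 0 ≤ q → IsLqSpec (Measure.map Prod.fst μ) q (τ1 q))
    (hτ2 : ∀ q : ℝ, 0 ≤ q → IsLqSpec (Measure.map Prod.snd μ) q (τ2 q))
    (P : ℝ → ℝ → ℝ)
    (hP : ∀ s q : ℝ, 0 ≤ q →
      Tendsto (fun k : ℕ => PsiSV B p τ1 τ2 k s q ^ ((k : ℝ)⁻¹)) atTop (nhds (P s q)))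
    (γ : ℝ → ℝ) (hγ : ∀ q : ℝ, 0 ≤ q → P (γ q) q = 1)
    (hsep : ∀ i, B.swap i = false)
    (γA γB : ℝ → ℝ)
    (hγA : ∀ q : ℝ, 0 ≤ q → ∑ i : ι, p i ^ q * B.c i ^ τ1 q * B.d i ^ (γA q - τ1 q) = 1)
    (hγB : ∀ q : ℝ, 0 ≤ q → ∑ i : ι, p i ^ q * B.d i ^ τ2 q * B.c i ^ (γB q - τ2 q) = 1)
     :
    (∀ q : ℝ, 0 ≤ q →
      ((max (γA q) (γB q) ≤ τ1 q + τ2 q → γ q = max (γA q) (γB q)) ∧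
       (τ1 q + τ2 q ≤ min (γA q) (γB q) →
          γ q ≤ min (γA q) (γB q) ∧
          ((0 ≤ ∑ i : ι, p i ^ q * B.c i ^ τ1 q * B.d i ^ (γA q - τ1 q) *
                Real.log (B.c i / B.d i) ∨
            0 ≤ ∑ i : ι, p i ^ q * B.d i ^ τ2 q * B.c i ^ (γB q - τ2 q) *
                Real.log (B.d i / B.c i)) →
            γ q = min (γA q) (γB q))))) ∧
    ((∀ i, B.d i ≤ B.c i) → ∀ q : ℝ, 0 ≤ q → γ q = γA q) ∧
    ((∀ i, B.c i ≤ B.d i) → ∀ q : ℝ, 0 ≤ q → γ q = γB q) := by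
  have hp0 : ∀ i, 0 < p i := fun i => (hp i).1
  have hc0 : ∀ i, 0 < B.c i := fun i => (hc i).1
  have hd0 : ∀ i, 0 < B.d i := fun i => (hd i).1
  have hPsi0 : ∀ s q k, 0 ≤ PsiSV B p τ1 τ2 k s q := fun s q k =>
    Finset.sum_nonneg fun f _ => (psi_pos B hsep p hp0 hc0 hd0 τ1 τ2 s q _).1.le
  obtain ⟨i0, hi0⟩ := Finite.exists_max B.d
  have hmono : ∀ q, 0 ≤ q → ∀ s s', s < s' → P s q ≤ 1 → P s' q < 1 := by
    intro q hq s s' hss h1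
    have h2 := lim_root_mono (a := B.d i0 ^ (s' - s)) (Real.rpow_nonneg (hd0 i0).le _)
      (hPsi0 s q) (hPsi0 s' q) (hP s q hq)
      (hP s' q hq) (Psi_mono B hsep p hp0 hc0 hd0 τ1 τ2 q _ (hd0 i0) hi0 s s' hss.le)
    have h3 : B.d i0 ^ (s' - s) < 1 :=
      Real.rpow_lt_one (hd0 i0).le (hd i0).2 (by linarith)
    have h4 : 0 < B.d i0 ^ (s' - s) := Real.rpow_pos_of_pos (hd0 i0) _
    nlinarith
  have hup : ∀ q, 0 ≤ q → ∀ s, (∀ k, PsiSV B p τ1 τ2 k s q ≤ 2) → γ q ≤ s := by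
    intro q hq s h
    by_contra! hlt
    have := hmono q hq s (γ q) hlt (lim_root_le (hPsi0 s q) (hP s q hq) h)
    linarith [hγ q hq]
  have hlow : ∀ q, 0 ≤ q → ∀ s K, (∀ k : ℕ, 0 < k → Real.exp (- (Real.sqrt k * K)) ≤
      PsiSV B p τ1 τ2 k s q) → s ≤ γ q := by
    intro q hq s K h
    by_contra! hlt
    have := hmono q hq (γ q) s hlt (hγ q hq).le
    linarith [lim_root_ge (hP s q hq) h]
  have hlow1 : ∀ q, 0 ≤ q → ∀ s, (∀ k : ℕ, 1 ≤ PsiSV B p τ1 τ2 k s q) → s ≤ γ q := by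
    intro q hq s h
    refine hlow q hq s 0 fun k _ => ?_
    simpa using h k
  let A : ℝ → ℝ → ι → ℝ := fun q s i => p i ^ q * B.c i ^ τ1 q * B.d i ^ (s - τ1 q)
  let A' : ℝ → ℝ → ι → ℝ := fun q s i => p i ^ q * B.d i ^ τ2 q * B.c i ^ (s - τ2 q)
  have hA0 : ∀ q s i, 0 ≤ A q s i := fun q s i => by
    have := hp0 i; have := hc0 i; have := hd0 i
    simp only [A]; positivity
  have hA0' : ∀ q s i, 0 ≤ A' q s i := fun q s i => by
    have := hp0 i; have := hc0 i; have := hd0 i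
    simp only [A']; positivity
  have hW0 : ∀ (w : ι → ℝ) (l : List ι), (∀ i, 0 ≤ w i) → 0 ≤ (l.map w).prod := by
    intro w l hw
    apply List.prod_nonneg
    intro x hx
    obtain ⟨i, _, rfl⟩ := List.mem_map.1 hx
    exact hw i
  let y : ι → ℝ := fun i => Real.log (B.c i / B.d i)
  let y' : ι → ℝ := fun i => Real.log (B.d i / B.c i)
  have hpsi : ∀ (q s : ℝ) (l : List ι), ((l.map B.d).prod ≤ (l.map B.c).prod ∧ 0 ≤ (l.map y).sum ∧
        (l.map y').sum ≤ 0 ∧ psiSV B p τ1 τ2 s q l = (l.map (A q s)).prod) ∨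
      ((l.map B.c).prod ≤ (l.map B.d).prod ∧ (l.map y).sum ≤ 0 ∧
        0 ≤ (l.map y').sum ∧ psiSV B p τ1 τ2 s q l = (l.map (A' q s)).prod) := by
    intro q s l
    obtain ⟨-, -, h3, h4, h5⟩ := word_formula p B.c B.d hp0 hc0 hd0 q (τ1 q) (s - τ1 q) l
    obtain ⟨-, -, -, -, g5⟩ := word_formula p B.d B.c hp0 hd0 hc0 q (τ1 q) (s - τ1 q) l
    have h6 := psi_cases B hsep p hp0 hc0 hd0 τ1 τ2 s q l
    rcases le_total (l.map B.d).prod (l.map B.c).prod with h | h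
    · left
      have := Real.log_le_log h4 h
      refine ⟨h, ?_, ?_, h6.1 h⟩
      · simp only [y]; linarith
      · simp only [y']; linarith
    · right
      have := Real.log_le_log h3 h
      refine ⟨h, ?_, ?_, h6.2 h⟩
      · simp only [y]; linarith
      · simp only [y']; linarith
  have hr1 : ∀ (q s : ℝ) (l : List ι), (l.map (A' q s)).prod = (l.map (A q s)).prod *
      Real.exp ((s - (τ1 q + τ2 q)) * (l.map y).sum) := fun q s l =>
    AB_ratio p B.c B.d hp0 hc0 hd0 q s (τ1 q) (τ2 q) l
  have hr2 : ∀ (q s : ℝ) (l : List ι), (l.map (A q s)).prod = (l.map (A' q s)).prod *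
      Real.exp ((s - (τ1 q + τ2 q)) * (l.map y').sum) := fun q s l => by
    rw [add_comm]
    exact AB_ratio p B.d B.c hp0 hd0 hc0 q s (τ2 q) (τ1 q) l
  have hAle : ∀ q, 0 ≤ q → ∀ s, γA q ≤ s → ∀ k : ℕ,
      ∑ f : Fin k → ι, ((List.ofFn f).map (A q s)).prod ≤ 1 := by
    intro q hq s hs k
    rw [sum_words_prod]
    exact pow_le_one₀ (Finset.sum_nonneg fun i _ => hA0 q s i)
      (weight_anti p B.c B.d hp0 hc0 hd q (τ1 q) (γA q) s hs (hγA q hq))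
  have hAle' : ∀ q, 0 ≤ q → ∀ s, γB q ≤ s → ∀ k : ℕ,
      ∑ f : Fin k → ι, ((List.ofFn f).map (A' q s)).prod ≤ 1 := by
    intro q hq s hs k
    rw [sum_words_prod]
    exact pow_le_one₀ (Finset.sum_nonneg fun i _ => hA0' q s i)
      (weight_anti p B.d B.c hp0 hd0 hc q (τ2 q) (γB q) s hs (hγB q hq))
  have hAeq : ∀ q, 0 ≤ q → ∀ k : ℕ,
      ∑ f : Fin k → ι, ((List.ofFn f).map (A q (γA q))).prod = 1 := by
    intro q hq k
    rw [sum_words_prod]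
    simp only [A]
    rw [hγA q hq, one_pow]
  have hAeq' : ∀ q, 0 ≤ q → ∀ k : ℕ,
      ∑ f : Fin k → ι, ((List.ofFn f).map (A' q (γB q))).prod = 1 := by
    intro q hq k
    rw [sum_words_prod]
    simp only [A']
    rw [hγB q hq, one_pow]
  refine ⟨fun q hq => ⟨fun hmax => ?_, fun hmin => ⟨?_, fun hor => ?_⟩⟩, fun hcd q hq => ?_,
    fun hcd q hq => ?_⟩
  · skip
    set s := max (γA q) (γB q) with hs
    have hθ : s - (τ1 q + τ2 q) ≤ 0 := by linarith
    have hge : ∀ l : List ι, (l.map (A q s)).prod ≤ psiSV B p τ1 τ2 s q l := by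
      intro l
      rcases hpsi q s l with ⟨-, -, -, h⟩ | ⟨-, -, h1, h⟩
      · exact h.ge
      · rw [h, hr2]
        refine mul_le_of_le_one_right (hW0 _ _ (hA0' q s)) (Real.exp_le_one_iff.2 ?_)
        exact mul_nonpos_of_nonpos_of_nonneg hθ h1
    have hge' : ∀ l : List ι, (l.map (A' q s)).prod ≤ psiSV B p τ1 τ2 s q l := by
      intro l
      rcases hpsi q s l with ⟨-, h1, -, h⟩ | ⟨-, -, -, h⟩
      · rw [h, hr1]
        refine mul_le_of_le_one_right (hW0 _ _ (hA0 q s)) (Real.exp_le_one_iff.2 ?_)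
        exact mul_nonpos_of_nonpos_of_nonneg hθ h1
      · exact h.ge
    apply le_antisymm
    · refine hup q hq s fun k => ?_
      calc PsiSV B p τ1 τ2 k s q ≤ ∑ f : Fin k → ι, (((List.ofFn f).map (A q s)).prod +
            ((List.ofFn f).map (A' q s)).prod) := by
            refine Finset.sum_le_sum fun f _ => ?_
            have := hW0 (A q s) (List.ofFn f) (hA0 q s)
            have := hW0 (A' q s) (List.ofFn f) (hA0' q s)
            rcases hpsi q s (List.ofFn f) with ⟨-, -, -, h⟩ | ⟨-, -, -, h⟩ <;> linarith
        _ ≤ 2 := by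
            rw [Finset.sum_add_distrib]
            linarith [hAle q hq s (le_max_left _ _) k, hAle' q hq s (le_max_right _ _) k]
    · refine hlow1 q hq s fun k => ?_
      rcases max_choice (γA q) (γB q) with h | h
      · rw [← hs] at h
        rw [← hAeq q hq k, ← h]
        exact Finset.sum_le_sum fun f _ => hge _
      · rw [← hs] at h
        rw [← hAeq' q hq k, ← h]
        exact Finset.sum_le_sum fun f _ => hge' _
  · skip
    obtain ⟨hm1, hm2⟩ := le_min_iff.1 hmin
    apply le_min
    · refine hup q hq _ fun k => ?_
      refine le_trans ?_ (show (1 : ℝ) ≤ 2 by norm_num)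
      rw [← hAeq q hq k]
      refine Finset.sum_le_sum fun f _ => ?_
      rcases hpsi q (γA q) (List.ofFn f) with ⟨-, -, -, h⟩ | ⟨-, h1, -, h⟩
      · exact h.le
      · rw [h, hr1]
        refine mul_le_of_le_one_right (hW0 _ _ (hA0 q _)) (Real.exp_le_one_iff.2 ?_)
        exact mul_nonpos_of_nonneg_of_nonpos (by linarith) h1
    · refine hup q hq _ fun k => ?_
      refine le_trans ?_ (show (1 : ℝ) ≤ 2 by norm_num)
      rw [← hAeq' q hq k]
      refine Finset.sum_le_sum fun f _ => ?_
      rcases hpsi q (γB q) (List.ofFn f) with ⟨-, -, h1, h⟩ | ⟨-, -, -, h⟩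
      · rw [h, hr2]
        refine mul_le_of_le_one_right (hW0 _ _ (hA0' q _)) (Real.exp_le_one_iff.2 ?_)
        exact mul_nonpos_of_nonneg_of_nonpos (by linarith) h1
      · exact h.le
  · skip
    obtain ⟨hm1, hm2⟩ := le_min_iff.1 hmin
    apply le_antisymm
    · apply le_min
      · refine hup q hq _ fun k => ?_
        refine le_trans ?_ (show (1 : ℝ) ≤ 2 by norm_num)
        rw [← hAeq q hq k]
        refine Finset.sum_le_sum fun f _ => ?_
        rcases hpsi q (γA q) (List.ofFn f) with ⟨-, -, -, h⟩ | ⟨-, h1, -, h⟩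
        · exact h.le
        · rw [h, hr1]
          refine mul_le_of_le_one_right (hW0 _ _ (hA0 q _)) (Real.exp_le_one_iff.2 ?_)
          exact mul_nonpos_of_nonneg_of_nonpos (by linarith) h1
      · refine hup q hq _ fun k => ?_
        refine le_trans ?_ (show (1 : ℝ) ≤ 2 by norm_num)
        rw [← hAeq' q hq k]
        refine Finset.sum_le_sum fun f _ => ?_
        rcases hpsi q (γB q) (List.ofFn f) with ⟨-, -, h1, h⟩ | ⟨-, -, -, h⟩
        · rw [h, hr2]
          refine mul_le_of_le_one_right (hW0 _ _ (hA0' q _)) (Real.exp_le_one_iff.2 ?_)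
          exact mul_nonpos_of_nonneg_of_nonpos (by linarith) h1
        · exact h.le
    · rcases hor with hor | hor
      · refine (min_le_left _ _).trans ?_
        obtain ⟨K, hK⟩ := words_lower (A q (γA q)) y (hA0 q _) (hγA q hq) hor
          (γA q - (τ1 q + τ2 q)) (by linarith)
        refine hlow q hq _ K fun k hk => (hK k hk).trans (Finset.sum_le_sum fun f _ => ?_)
        have h0 := hW0 (A q (γA q)) (List.ofFn f) (hA0 q _)
        rcases hpsi q (γA q) (List.ofFn f) with ⟨-, -, -, h⟩ | ⟨-, h1, -, h⟩
        · rw [h]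
          exact mul_le_of_le_one_right h0 (min_le_left _ _)
        · rw [h, hr1]
          exact mul_le_mul_of_nonneg_left (min_le_right _ _) h0
      · refine (min_le_right _ _).trans ?_
        obtain ⟨K, hK⟩ := words_lower (A' q (γB q)) y' (hA0' q _) (hγB q hq) hor
          (γB q - (τ1 q + τ2 q)) (by linarith)
        refine hlow q hq _ K fun k hk => (hK k hk).trans (Finset.sum_le_sum fun f _ => ?_)
        have h0 := hW0 (A' q (γB q)) (List.ofFn f) (hA0' q _)
        rcases hpsi q (γB q) (List.ofFn f) with ⟨-, -, -, h⟩ | ⟨-, h1, -, h⟩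
        · rw [h, hr2]
          exact mul_le_mul_of_nonneg_left (min_le_right _ _) h0
        · rw [h]
          exact mul_le_of_le_one_right h0 (min_le_left _ _)
  · have hle : ∀ l : List ι, (l.map B.d).prod ≤ (l.map B.c).prod := by
      intro l
      induction l with
      | nil => simp
      | cons i l ih =>
        simp only [List.map_cons, List.prod_cons]
        exact mul_le_mul (hcd i) ih (hW0 _ _ fun i => (hd0 i).le) (hc0 i).le
    have h1 : ∀ k, PsiSV B p τ1 τ2 k (γA q) q = 1 := by
      intro k
      rw [← hAeq q hq k]
      exact Finset.sum_congr rfl fun f _ =>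
        (psi_cases B hsep p hp0 hc0 hd0 τ1 τ2 (γA q) q _).1 (hle _)
    exact le_antisymm (hup q hq _ fun k => by rw [h1]; norm_num) (hlow1 q hq _ fun k => (h1 k).ge)
  · have hle : ∀ l : List ι, (l.map B.c).prod ≤ (l.map B.d).prod := by
      intro l
      induction l with
      | nil => simp
      | cons i l ih =>
        simp only [List.map_cons, List.prod_cons]
        exact mul_le_mul (hcd i) ih (hW0 _ _ fun i => (hc0 i).le) (hd0 i).le
    have h1 : ∀ k, PsiSV B p τ1 τ2 k (γB q) q = 1 := by
      intro k
      rw [← hAeq' q hq k]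
      exact Finset.sum_congr rfl fun f _ =>
        (psi_cases B hsep p hp0 hc0 hd0 τ1 τ2 (γB q) q _).2 (hle _)
    exact le_antisymm (hup q hq _ fun k => by rw [h1]; norm_num) (hlow1 q hq _ fun k => (h1 k).ge)
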